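/- Let X be a compact set in C^n, z in X, and mu, nu in J_z(X). If mu is subordinated to nu and nu is subordinated to mu, then mu = nu. -/

import Mathlib

open MeasureTheory Metric Filter Topology Set Complex
open scoped ENNReal

noncomputable section

/-- `ℂⁿ`. -/
abbrev En (n : ℕ) : Type := EuclideanSpace ℂ (Fin n)

instance (n : ℕ) : MeasurableSpace (En n) := borel _

instance (n : ℕ) : BorelSpace (En n) := ⟨rfl⟩

open Classical in
/-- The positive part of an extended real number, as an element of `ℝ≥0∞`. -/
def epos (x : EReal) : ℝ≥0∞ := if x = ⊤ then ⊤ else ENNReal.ofReal x.toReal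

/-- The integral of an `EReal`-valued function `u` against a measure `μ`, defined as the
difference of the lower integrals of the positive and negative parts of `u`. -/
def eint {α : Type*} [MeasurableSpace α] (μ : Measure α) (u : α → EReal) : EReal :=
  ((∫⁻ x, epos (u x) ∂μ : ℝ≥0∞) : EReal) - ((∫⁻ x, epos (-(u x)) ∂μ : ℝ≥0∞) : EReal)

/-- The normalized angular measure `(2π)⁻¹ dθ` on `[0, 2π)`. -/
def thetaM : Measure ℝ :=
  (ENNReal.ofReal ((2 * Real.pi)⁻¹)) • (volume.restrict (Set.Ico (0 : ℝ) (2 * Real.pi)))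

/-- A function `u` with values in `[-∞, ∞)` is plurisubharmonic on an open set `U ⊆ ℂⁿ`:
it is upper semicontinuous, `< ⊤`, and satisfies the sub-mean-value inequality on every
complex line. -/
def PshOnE {n : ℕ} (u : En n → EReal) (U : Set (En n)) : Prop :=
  UpperSemicontinuousOn u U ∧ (∀ z ∈ U, u z < ⊤) ∧
  ∀ z ∈ U, ∀ w : En n, ∀ r : ℝ, 0 < r →
    (∀ ζ : ℂ, ‖ζ‖ ≤ r → z + ζ • w ∈ U) →
    u z ≤ eint thetaM (fun θ => u (z + (circleMap 0 r θ) • w))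

/-- `μ` is a Jensen measure on `X` with barycenter `z`:  a Borel probability measure
supported on `X` such that `u z ≤ ∫ u dμ` for every function `u` continuous and
plurisubharmonic on some open neighborhood of `X`. -/
def IsJensen {n : ℕ} (X : Set (En n)) (z : En n) (μ : Measure (En n)) : Prop :=
  IsProbabilityMeasure μ ∧ μ Xᶜ = 0 ∧
  ∀ U : Set (En n), IsOpen U → X ⊆ U →
    ∀ u : En n → EReal, ContinuousOn u U → PshOnE u U → u z ≤ eint μ u

/-- `u : X → [-∞, ∞)` is plurisubharmonic on the compact set `X` : it is upper
semicontinuous on `X`, `< ⊤` on `X`, and satisfies the subaveraging inequality with respect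
to all Jensen measures on `X`. -/
def PSHe {n : ℕ} (X : Set (En n)) (u : En n → EReal) : Prop :=
  UpperSemicontinuousOn u X ∧ (∀ z ∈ X, u z < ⊤) ∧
  ∀ z ∈ X, ∀ μ : Measure (En n), IsJensen X z μ → u z ≤ eint μ u

/-- `PSH^c(X)`: continuous plurisubharmonic functions on `X`. -/
def PSHce {n : ℕ} (X : Set (En n)) (u : En n → EReal) : Prop :=
  PSHe X u ∧ ContinuousOn u X

/-- Real-valued continuous plurisubharmonic functions on `X`. -/
def PSHcR {n : ℕ} (X : Set (En n)) (u : En n → ℝ) : Prop :=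
  ContinuousOn u X ∧ PSHe X (fun x => (u x : EReal))

/-- `O_X`: the set of points `z ∈ X` whose only Jensen measure is `δ_z`. -/
def Oset {n : ℕ} (X : Set (En n)) : Set (En n) :=
  {z | z ∈ X ∧ ∀ μ : Measure (En n), IsJensen X z μ → μ = Measure.dirac z}

/-- The potential boundary `B_X`, the closure of `O_X`. -/
def Bset {n : ℕ} (X : Set (En n)) : Set (En n) := closure (Oset X)

/-- `J^b_z(X)`: Jensen measures with barycenter `z` supported on `B_X`. -/
def IsJensenB {n : ℕ} (X : Set (En n)) (z : En n) (μ : Measure (En n)) : Prop :=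
  IsJensen X z μ ∧ μ (Bset X)ᶜ = 0

/-- `ν` is subordinated to `μ` : `μ(u) ≥ ν(u)` for all `u ∈ PSH^c(X)`. -/
def Subord {n : ℕ} (X : Set (En n)) (μ ν : Measure (En n)) : Prop :=
  ∀ u : En n → EReal, PSHce X u → eint ν u ≤ eint μ u

/-- Subharmonic functions with values in `[-∞, ∞)` on an open set `U ⊆ ℂ`. -/
def SubharmOn (u : ℂ → EReal) (U : Set ℂ) : Prop :=
  UpperSemicontinuousOn u U ∧ (∀ z ∈ U, u z < ⊤) ∧
  ∀ z ∈ U, ∀ r : ℝ, 0 < r → closedBall z r ⊆ U →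
    u z ≤ eint thetaM (fun θ => u (circleMap z r θ))

/-- Harmonic (real-valued) functions on an open set `U ⊆ ℂ`: continuous functions
satisfying the mean-value equality. -/
def HarmOn (h : ℂ → ℝ) (U : Set ℂ) : Prop :=
  ContinuousOn h U ∧
  ∀ z ∈ U, ∀ r : ℝ, 0 < r → closedBall z r ⊆ U →
    h z = (2 * Real.pi)⁻¹ * ∫ θ in (0 : ℝ)..(2 * Real.pi), h (circleMap z r θ)

/-- Superharmonic (real-valued) functions on an open set `U ⊆ ℂ`. -/
def SuperharmOn (v : ℂ → ℝ) (U : Set ℂ) : Prop :=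
  LowerSemicontinuousOn v U ∧
  ∀ z ∈ U, ∀ r : ℝ, 0 < r → closedBall z r ⊆ U →
    (2 * Real.pi)⁻¹ * (∫ θ in (0 : ℝ)..(2 * Real.pi), v (circleMap z r θ)) ≤ v z

/-- The infimum of all positive superharmonic functions on the unit disk, extending
continuously to the closed disk and `≥ 1` on `A`, evaluated at `z`. -/
def hmPre (A : Set ℂ) (z : ℂ) : ℝ :=
  sInf {t : ℝ | ∃ v : ℂ → ℝ, SuperharmOn v (ball 0 1) ∧ (∀ w ∈ ball (0 : ℂ) 1, 0 < v w) ∧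
    ContinuousOn v (closedBall 0 1) ∧ (∀ w ∈ A, 1 ≤ v w) ∧ t = v z}

/-- The harmonic measure `ω(z, A, 𝔻)` of `A` with respect to the unit disk. -/
def hm (z : ℂ) (A : Set ℂ) : ℝ := Filter.liminf (fun w => hmPre A w) (𝓝 z)

open Classical in
/-- The radial limit of a map `f` at the boundary point `ζ` of the unit circle
(junk value `0` if the radial limit does not exist). -/
def bval {n : ℕ} (f : ℂ → En n) (ζ : ℂ) : En n :=
  if h : ∃ l : En n, Tendsto (fun r : ℝ => f ((r : ℂ) * ζ)) (𝓝[<] (1 : ℝ)) (𝓝 l)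
  then h.choose else 0

open Classical in
/-- The radial limit of an `EReal`-valued function on the disk at the boundary point `ζ`. -/
def bvalE (g : ℂ → EReal) (ζ : ℂ) : EReal :=
  if h : ∃ l : EReal, Tendsto (fun r : ℝ => g ((r : ℂ) * ζ)) (𝓝[<] (1 : ℝ)) (𝓝 l)
  then h.choose else 0

/-- `μ_f`: the push-forward of the normalized arclength measure on the unit circle under the
radial boundary values of `f`. -/
def bmeas {n : ℕ} (f : ℂ → En n) : Measure (En n) :=
  thetaM.map (fun θ => bval f (circleMap 0 1 θ))

/-- Weak-* convergence of a sequence of measures on `ℂⁿ`. -/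
def WeakConv {n : ℕ} (μs : ℕ → Measure (En n)) (μ : Measure (En n)) : Prop :=
  ∀ φ : BoundedContinuousFunction (En n) ℝ,
    Tendsto (fun j => ∫ x, φ x ∂(μs j)) atTop (𝓝 (∫ x, φ x ∂μ))

/-- The cluster set `cl L` of a sequence of maps of the unit disk into `ℂⁿ`. -/
def clusterSet {n : ℕ} (f : ℕ → ℂ → En n) : Set (En n) :=
  {z | ∀ r : ℝ, 0 < r → ∀ N : ℕ, ∃ j, N ≤ j ∧ ∃ ζ ∈ ball (0 : ℂ) 1, f j ζ ∈ ball z r}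

/-- A point `z` is totally essential for the sequence `f` if for every open set `V ∋ z` the
harmonic measures at `0` of `f j ⁻¹' V` stay bounded away from `0`. -/
def TotallyEssential {n : ℕ} (f : ℕ → ℂ → En n) (z : En n) : Prop :=
  ∀ V : Set (En n), IsOpen V → z ∈ V →
    0 < Filter.atTop.liminf (fun j => hm 0 ((f j ⁻¹' V) ∩ ball 0 1))

/-- A totally perfect sequence `L` of holomorphic maps of the unit disk into `ℂⁿ`: a
uniformly bounded sequence of holomorphic maps which is weak-* converging (with limit measure
`μ_L` and center `z_L`) and all of whose cluster points are totally essential. -/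
structure PerfectSeq (n : ℕ) where
  f : ℕ → ℂ → En n
  holo : ∀ j, DifferentiableOn ℂ (f j) (ball 0 1)
  bdd : ∃ C : ℝ, ∀ j, ∀ ζ ∈ ball (0 : ℂ) 1, ‖f j ζ‖ ≤ C
  μL : Measure (En n)
  conv : WeakConv (fun j => bmeas (f j)) μL
  zL : En n
  center : Tendsto (fun j => f j 0) atTop (𝓝 zL)
  ess : ∀ z ∈ clusterSet f, TotallyEssential f z

/-- `J_z^s(L)`: the measures obtained as weak-* limits of `μ_{f_{j_k} ∘ g_k}` for subsequences
`{j_k}` and holomorphic maps `g_k : 𝔻 → 𝔻` with `f_{j_k}(g_k(0)) → z`. -/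
def JsSet {n : ℕ} (L : PerfectSeq n) (z : En n) : Set (Measure (En n)) :=
  {μ | ∃ jk : ℕ → ℕ, StrictMono jk ∧ ∃ g : ℕ → ℂ → ℂ,
    (∀ k, DifferentiableOn ℂ (g k) (ball 0 1) ∧ MapsTo (g k) (ball 0 1) (ball 0 1)) ∧
    WeakConv (fun k => bmeas ((L.f (jk k)) ∘ (g k))) μ ∧
    Tendsto (fun k => L.f (jk k) (g k 0)) atTop (𝓝 z)}

/-- `J_z(L)`: the convex hull of `J_z^s(L)`. -/
def JLSet {n : ℕ} (L : PerfectSeq n) (z : En n) : Set (Measure (En n)) :=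
  {μ | ∃ (m : ℕ) (w : Fin m → ℝ) (ν : Fin m → Measure (En n)),
    (∀ i, 0 ≤ w i) ∧ (∑ i, w i = 1) ∧ (∀ i, ν i ∈ JsSet L z) ∧
    μ = ∑ i, (ENNReal.ofReal (w i)) • ν i}

/-- `u` is harmonic on the totally perfect sequence `L`. -/
def HarmonicOnL {n : ℕ} (L : PerfectSeq n) (u : En n → EReal) : Prop :=
  PSHce (clusterSet L.f) u ∧
  ∀ z ∈ clusterSet L.f, ∀ μ ∈ JLSet L z, eint μ u = u z

/-- `PSH^w(X)`: weakly plurisubharmonic functions, the upper envelopes of nonempty families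
of continuous plurisubharmonic functions on `X`. -/
def PSHw {n : ℕ} (X : Set (En n)) (u : En n → EReal) : Prop :=
  ∃ F : Set (En n → EReal), F.Nonempty ∧ (∀ v ∈ F, PSHce X v) ∧
    ∀ x ∈ X, u x = ⨆ v ∈ F, v x

/-- `u` is maximal on `X ∖ Z`: for every relatively open `V ⊆ X ∖ Z` and every
`v ∈ PSH^c(closure V)`, if `v ≤ u` on the relative boundary of `V` in `X` then `v ≤ u`
on `closure V`. -/
def MaximalOn {n : ℕ} (X Z : Set (En n)) (u : En n → EReal) : Prop :=
  ∀ W : Set (En n), IsOpen W → X ∩ W ⊆ X \ Z →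
    ∀ v : En n → EReal, PSHce (closure (X ∩ W)) v →
      (∀ x ∈ closure (X ∩ W) \ (X ∩ W), v x ≤ u x) →
      ∀ x ∈ closure (X ∩ W), v x ≤ u x

/-- Pluriharmonic continuous real-valued functions on `X`. -/
def Pluriharm {n : ℕ} (X : Set (En n)) (h : En n → ℝ) : Prop :=
  ContinuousOn h X ∧
  ∀ z ∈ X, ∀ μ : Measure (En n), IsJensen X z μ → (h z : EReal) = eint μ (fun x => (h x : EReal))

/-- `X` is a Poisson set: every continuous real-valued function on `B_X` extends to a
pluriharmonic function on `X`. -/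
def PoissonSet {n : ℕ} (X : Set (En n)) : Prop :=
  ∀ φ : En n → ℝ, ContinuousOn φ (Bset X) →
    ∃ h : En n → ℝ, Pluriharm X h ∧ ∀ w ∈ Bset X, h w = φ w

end

lemma epos_coe (x : ℝ) : epos (x : EReal) = ENNReal.ofReal x := by
  simp [epos]

lemma eint_coe_of_nonneg {α : Type*} [MeasurableSpace α] (μ : Measure α) {f : α → ℝ}
    (hf : ∀ x, 0 ≤ f x) :
    eint μ (fun x => (f x : EReal)) = ((∫⁻ x, ENNReal.ofReal (f x) ∂μ : ℝ≥0∞) : EReal) := by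
  simp_rw [eint, ← EReal.coe_neg, epos_coe, ENNReal.ofReal_of_nonpos (neg_nonpos.2 (hf _))]
  simp

lemma integral_thetaM {E : Type*} [NormedAddCommGroup E] [NormedSpace ℝ E] (f : ℝ → E) :
    ∫ θ, f θ ∂thetaM = (2 * Real.pi)⁻¹ • ∫ θ in (0 : ℝ)..(2 * Real.pi), f θ := by
  rw [thetaM, integral_smul_measure, integral_Ico_eq_integral_Ioc,
    intervalIntegral.integral_of_le Real.two_pi_pos.le,
    ENNReal.toReal_ofReal (inv_nonneg.2 Real.two_pi_pos.le)]

/-- The sub-mean-value inequality for the modulus of an entire function. -/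
lemma enorm_le_lintegral_thetaM {G : ℂ → ℂ} (hG : Differentiable ℂ G) (r : ℝ) :
    ‖G 0‖ₑ ≤ ∫⁻ θ, ‖G (circleMap 0 r θ)‖ₑ ∂thetaM := by
  have h : ∫ θ, G (circleMap 0 r θ) ∂thetaM = G 0 := by
    rw [integral_thetaM, ← Real.circleAverage_def]
    exact hG.diffContOnCl.circleAverage
  exact h ▸ enorm_integral_le_lintegral_enorm _

section

variable {n : ℕ}

lemma continuous_coe_exp_dual (L : StrongDual ℝ (En n)) :
    Continuous (fun x => ((Real.exp (L x) : ℝ) : EReal)) :=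
  continuous_coe_real_ereal.comp (Real.continuous_exp.comp L.continuous)

/-- Exponentials of real linear functionals are plurisubharmonic on `ℂⁿ`. -/
lemma pshOnE_exp_dual (L : StrongDual ℝ (En n)) :
    PshOnE (fun x => ((Real.exp (L x) : ℝ) : EReal)) univ := by
  refine ⟨(continuous_coe_exp_dual L).upperSemicontinuous.upperSemicontinuousOn _,
    fun _ _ => EReal.coe_lt_top _, fun z _ w r _ _ => ?_⟩
  rw [eint_coe_of_nonneg _ fun _ => (Real.exp_pos _).le]
  let F : StrongDual ℂ (En n) := L.extendRCLike
  have hF (x : En n) : ‖Complex.exp (F x)‖ = Real.exp (L x) := by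
    rw [Complex.norm_exp]
    exact congrArg Real.exp (StrongDual.re_extendRCLike_apply (𝕜 := ℂ) L x)
  have hG : Differentiable ℂ fun ζ : ℂ => Complex.exp (F (z + ζ • w)) := by fun_prop
  have key := enorm_le_lintegral_thetaM hG r
  simp_rw [← ofReal_norm, hF, zero_smul, add_zero] at key
  calc ((Real.exp (L z) : ℝ) : EReal) = ((ENNReal.ofReal (Real.exp (L z)) : ℝ≥0∞) : EReal) := by
        rw [EReal.coe_ennreal_ofReal, max_eq_left (Real.exp_pos _).le]
    _ ≤ _ := EReal.coe_ennreal_le_coe_ennreal_iff.2 key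

lemma pshce_exp_dual (X : Set (En n)) (L : StrongDual ℝ (En n)) :
    PSHce X (fun x => ((Real.exp (L x) : ℝ) : EReal)) :=
  ⟨⟨(continuous_coe_exp_dual L).upperSemicontinuous.upperSemicontinuousOn _,
    fun _ _ => EReal.coe_lt_top _, fun _ _ _ hμ => hμ.2.2 univ isOpen_univ (subset_univ _) _
      (continuous_coe_exp_dual L).continuousOn (pshOnE_exp_dual L)⟩,
    (continuous_coe_exp_dual L).continuousOn⟩

lemma integral_exp_dual_eq_of_subord {X : Set (En n)} {μ ν : Measure (En n)}
    (hμν : Subord X μ ν) (hνμ : Subord X ν μ) (L : StrongDual ℝ (En n)) :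
    ∫ x, Real.exp (L x) ∂μ = ∫ x, Real.exp (L x) ∂ν := by
  have h := le_antisymm (hνμ _ (pshce_exp_dual X L)) (hμν _ (pshce_exp_dual X L))
  have hpos (x : En n) : 0 ≤ Real.exp (L x) := (Real.exp_pos _).le
  have hc : Continuous fun x => Real.exp (L x) := Real.continuous_exp.comp L.continuous
  rw [eint_coe_of_nonneg _ hpos, eint_coe_of_nonneg _ hpos, EReal.coe_ennreal_eq_coe_ennreal_iff]
    at h
  rw [integral_eq_lintegral_of_nonneg_ae (.of_forall hpos) hc.aestronglyMeasurable,
    integral_eq_lintegral_of_nonneg_ae (.of_forall hpos) hc.aestronglyMeasurable, h]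

lemma integrableExpSet_dual_eq_univ {X : Set (En n)} (hX : IsCompact X) {μ : Measure (En n)}
    [IsFiniteMeasure μ] (hμ : μ Xᶜ = 0) (L : StrongDual ℝ (En n)) :
    ProbabilityTheory.integrableExpSet L μ = univ := by
  obtain ⟨C, hC⟩ := hX.exists_bound_of_continuousOn L.continuous.continuousOn
  have hb : ∀ᵐ x ∂μ, L x ∈ Icc (-C) C := by
    filter_upwards [mem_ae_iff.2 hμ] with x hx
    exact abs_le.1 (hC x hx)
  exact eq_univ_of_forall fun t =>
    ProbabilityTheory.integrable_exp_mul_of_mem_Icc L.continuous.aemeasurable hb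

end

/-- Lemma 3.1: mutually subordinated Jensen measures coincide. -/
theorem stmt_2 {n : ℕ} (X : Set (En n)) (hX : IsCompact X) (z : En n) (hz : z ∈ X)
    (μ ν : Measure (En n)) (hμ : IsJensen X z μ) (hν : IsJensen X z ν)
    (hμν : Subord X μ ν) (hνμ : Subord X ν μ) : μ = ν := by
  have := hμ.1
  have := hν.1
  refine Measure.ext_of_charFunDual (funext fun L => ?_)
  have hmgf : ProbabilityTheory.mgf L μ = ProbabilityTheory.mgf L ν := by
    ext t
    simpa [ProbabilityTheory.mgf] using integral_exp_dual_eq_of_subord hμν hνμ (t • L)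
  have h := ProbabilityTheory.eqOn_complexMGF_of_mgf hmgf (x := Complex.I)
    (by simp [integrableExpSet_dual_eq_univ hX hμ.2.1 L])
  simpa [ProbabilityTheory.complexMGF, charFunDual_apply, mul_comm] using h
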